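/- Let (Λ,d) be a finitely aligned k-graph, E ⊆ Λ finite, and {t_λ : λ ∈ Λ} a Cuntz–Krieger Λ-family with t_v ≠ 0 for every vertex v. Then for all λ,μ ∈ ΠE with d(λ) = d(μ) and s(λ) = s(μ): Θ(t,E;λ,μ) = 0 if and only if T(λ) is an exhaustive subset of s(λ)Λ. -/

import Mathlib

open scoped BigOperators

/-- A `k`-graph: a countable small category (in arrows-only presentation, with objects
identified with the identity morphisms) together with a degree functor into `ℕ^k`
satisfying the factorisation property.  `comp l m` is the composite path `lm`
(first `m`, then `l` in categorical order; range `rng l`, source `src m`), and is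
only meaningful when `src l = rng m`. -/
structure KGraph (k : ℕ) where
  Path : Type
  countable : Countable Path
  src : Path → Path
  rng : Path → Path
  comp : Path → Path → Path
  deg : Path → Fin k → ℕ
  deg_src : ∀ l, deg (src l) = 0
  deg_rng : ∀ l, deg (rng l) = 0
  src_eq_of_deg_zero : ∀ v, deg v = 0 → src v = v
  rng_eq_of_deg_zero : ∀ v, deg v = 0 → rng v = v
  comp_src_self : ∀ l, comp l (src l) = l
  rng_comp_self : ∀ l, comp (rng l) l = l
  src_comp : ∀ l m, src l = rng m → src (comp l m) = src m
  rng_comp : ∀ l m, src l = rng m → rng (comp l m) = rng l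
  deg_comp : ∀ l m, src l = rng m → deg (comp l m) = deg l + deg m
  comp_assoc : ∀ l m n, src l = rng m → src m = rng n →
    comp (comp l m) n = comp l (comp m n)
  factorisation : ∀ (l : Path) (m n : Fin k → ℕ), deg l = m + n →
    ∃! p : Path × Path, deg p.1 = m ∧ deg p.2 = n ∧ src p.1 = rng p.2 ∧
      comp p.1 p.2 = l

namespace KGraph

variable {k : ℕ} (Λ : KGraph k)

/-- The vertices of a `k`-graph are the paths of degree `0`. -/
def IsVertex (v : Λ.Path) : Prop := Λ.deg v = 0

/-- An edge is a path of degree `e_i` for some `i`. -/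
def IsEdge (e : Λ.Path) : Prop := ∃ i : Fin k, Λ.deg e = Pi.single i 1

/-- `vΛ`, the set of paths with range `v`. -/
def withRange (v : Λ.Path) : Set Λ.Path := {l | Λ.rng l = v}

/-- `Λ^min(l,m)`, the set of pairs giving minimal common extensions of `l` and `m`. -/
def minExt (l m : Λ.Path) : Set (Λ.Path × Λ.Path) :=
  {p | Λ.src l = Λ.rng p.1 ∧ Λ.src m = Λ.rng p.2 ∧
    Λ.comp l p.1 = Λ.comp m p.2 ∧ Λ.deg (Λ.comp l p.1) = Λ.deg l ⊔ Λ.deg m}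

/-- A `k`-graph is finitely aligned if all the sets `Λ^min(l,m)` are finite. -/
def FinitelyAligned : Prop := ∀ l m, (Λ.minExt l m).Finite

/-- A subset `E ⊆ vΛ` is exhaustive if every path in `vΛ` has a common extension
with some member of `E`. -/
def Exhaustive (v : Λ.Path) (E : Set Λ.Path) : Prop :=
  ∀ m ∈ Λ.withRange v, ∃ l ∈ E, (Λ.minExt l m).Nonempty

/-- `Λ^{≤ n}`. -/
def degLe (n : Fin k → ℕ) : Set Λ.Path :=
  {l | Λ.deg l ≤ n ∧ ∀ i : Fin k, Λ.deg l i < n i →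
    ¬∃ e, Λ.rng e = Λ.src l ∧ Λ.deg e = Pi.single i 1}

end KGraph

open Classical in
/-- The sum of `f` over a set `S`, defined to be `0` if `S` is infinite. -/
noncomputable def setSum {ι A : Type*} [AddCommMonoid A] (S : Set ι) (f : ι → A) : A :=
  if h : S.Finite then ∑ i ∈ h.toFinset, f i else 0

open Classical in
/-- The product of `f` over a set `S` taken in an arbitrary (but fixed) order,
defined to be `1` if `S` is infinite.  All products appearing below have commuting
factors, for which this is the usual product over a finite set. -/
noncomputable def setProd {ι A : Type*} [Monoid A] (S : Set ι) (f : ι → A) : A :=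
  if h : S.Finite then (h.toFinset.toList.map f).prod else 1

namespace KGraph

variable {k : ℕ} (Λ : KGraph k) {A : Type*} [Ring A] [StarRing A]

/-- Relations (CK1)–(CK3) for a family of partial isometries indexed by a `k`-graph. -/
structure IsCK13 (t : Λ.Path → A) : Prop where
  partialIsometry : ∀ l, t l * star (t l) * t l = t l
  vertex_projection : ∀ v, Λ.IsVertex v → star (t v) = t v ∧ t v * t v = t v
  vertex_orthogonal : ∀ v w, Λ.IsVertex v → Λ.IsVertex w → v ≠ w → t v * t w = 0
  comp_mul : ∀ l m, Λ.src l = Λ.rng m → t l * t m = t (Λ.comp l m)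
  ck3 : ∀ l m, star (t l) * t m =
    setSum (Λ.minExt l m) fun p => t p.1 * star (t p.2)

/-- A Cuntz–Krieger `Λ`-family: relations (CK1)–(CK4). -/
structure IsCKFamily (t : Λ.Path → A) extends IsCK13 Λ t : Prop where
  ck4 : ∀ v E, Λ.IsVertex v → E ⊆ Λ.withRange v → E.Finite → Λ.Exhaustive v E →
    setProd E (fun l => t v - t l * star (t l)) = 0

/-- Condition (†) on a subset `F ⊆ Λ`. -/
def DaggerClosed (F : Set Λ.Path) : Prop :=
  ∀ l m σ τ a b, l ∈ F → m ∈ F → σ ∈ F → τ ∈ F →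
    Λ.deg l = Λ.deg m → Λ.deg σ = Λ.deg τ →
    Λ.src l = Λ.src m → Λ.src σ = Λ.src τ →
    (a, b) ∈ Λ.minExt m σ → Λ.comp l a ∈ F ∧ Λ.comp τ b ∈ F

/-- `ΠE`, the smallest subset of `Λ` containing `E` and satisfying (†). -/
def piSet (E : Set Λ.Path) : Set Λ.Path := ⋂₀ {F | E ⊆ F ∧ Λ.DaggerClosed F}

/-- For `P ⊆ Λ` and a path `l`, the set `{ν ∈ s(l)Λ : d(ν) > 0 and lν ∈ P}`;
with `P = ΠE` this is the set `T(l)`. -/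
def extInto (P : Set Λ.Path) (l : Λ.Path) : Set Λ.Path :=
  {ν | Λ.src l = Λ.rng ν ∧ Λ.deg ν ≠ 0 ∧ Λ.comp l ν ∈ P}

/-- The projection `Q(t)^{ΠE}_l`. -/
noncomputable def Qproj (t : Λ.Path → A) (E : Set Λ.Path) (l : Λ.Path) : A :=
  t l * star (t l) *
    setProd (Λ.extInto (Λ.piSet E) l)
      (fun ν => t l * star (t l) - t (Λ.comp l ν) * star (t (Λ.comp l ν)))

/-- The matrix unit `Θ(t,E;l,m) = Q(t)^{ΠE}_l t_l t_m^*`. -/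
noncomputable def Theta (t : Λ.Path → A) (E : Set Λ.Path) (l m : Λ.Path) : A :=
  Λ.Qproj t E l * (t l * star (t m))

end KGraph

/-- A degree-preserving functor `x : Ω_{k,m} → Λ` for some `m ∈ (ℕ ∪ {∞})^k`,
recorded by its degree `m` and its values `map p q` on the morphisms `(p,q)` of
`Ω_{k,m}` (normalised to the junk value `map 0 0` on pairs `(p,q)` that are not
morphisms of `Ω_{k,m}`). -/
structure OmegaMor {k : ℕ} (Λ : KGraph k) where
  m : Fin k → ℕ∞
  map : (Fin k → ℕ) → (Fin k → ℕ) → Λ.Path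
  deg_map : ∀ p q : Fin k → ℕ, p ≤ q → (∀ i, (q i : ℕ∞) ≤ m i) →
    Λ.deg (map p q) = q - p
  rng_map : ∀ p q : Fin k → ℕ, p ≤ q → (∀ i, (q i : ℕ∞) ≤ m i) →
    Λ.rng (map p q) = map p p
  src_map : ∀ p q : Fin k → ℕ, p ≤ q → (∀ i, (q i : ℕ∞) ≤ m i) →
    Λ.src (map p q) = map q q
  comp_map : ∀ p q r : Fin k → ℕ, p ≤ q → q ≤ r → (∀ i, (r i : ℕ∞) ≤ m i) →
    Λ.comp (map p q) (map q r) = map p r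
  map_default : ∀ p q : Fin k → ℕ, ¬(p ≤ q ∧ ∀ i, (q i : ℕ∞) ≤ m i) →
    map p q = map 0 0

/-- `x` is a boundary path: there is `n_x ≤ m` such that whenever `n_x ≤ n ≤ m`
and `n_i = m_i`, the vertex `x(n)` receives no edge of degree `e_i`. -/
def OmegaMor.IsBoundary {k : ℕ} {Λ : KGraph k} (x : OmegaMor Λ) : Prop :=
  ∃ nx : Fin k → ℕ, (∀ i, (nx i : ℕ∞) ≤ x.m i) ∧
    ∀ n : Fin k → ℕ, nx ≤ n → (∀ i, (n i : ℕ∞) ≤ x.m i) →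
      ∀ i : Fin k, (n i : ℕ∞) = x.m i →
        ¬∃ e, Λ.rng e = x.map n n ∧ Λ.deg e = Pi.single i 1


namespace KGraph

variable {k : ℕ} {Λ : KGraph k}

theorem rng_src (l : Λ.Path) : Λ.rng (Λ.src l) = Λ.src l :=
  Λ.rng_eq_of_deg_zero _ (Λ.deg_src l)

theorem eq_rng_of_deg_zero {a : Λ.Path} (h : Λ.deg a = 0) : a = Λ.rng a :=
  (Λ.rng_eq_of_deg_zero a h).symm

theorem comp_of_deg_zero {l a : Λ.Path} (h : Λ.src l = Λ.rng a) (ha : Λ.deg a = 0) :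
    Λ.comp l a = l := by
  rw [eq_rng_of_deg_zero ha, ← h, Λ.comp_src_self]

theorem comp_inj {a b c d : Λ.Path} (hab : Λ.src a = Λ.rng b) (hcd : Λ.src c = Λ.rng d)
    (hdeg : Λ.deg a = Λ.deg c) (h : Λ.comp a b = Λ.comp c d) : a = c ∧ b = d := by
  have hbd : Λ.deg b = Λ.deg d := by
    have h' := congrArg Λ.deg h
    rw [Λ.deg_comp _ _ hab, Λ.deg_comp _ _ hcd, hdeg] at h'
    exact add_left_cancel h'
  obtain ⟨p, -, hp⟩ := Λ.factorisation (Λ.comp c d) (Λ.deg c) (Λ.deg d) (Λ.deg_comp _ _ hcd)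
  have h₁ := hp (a, b) ⟨hdeg, hbd, hab, h⟩
  have h₂ := hp (c, d) ⟨rfl, rfl, hcd, rfl⟩
  exact Prod.mk.inj (h₁.trans h₂.symm)

theorem minExt_swap {l m a b : Λ.Path} (h : (a, b) ∈ Λ.minExt l m) : (b, a) ∈ Λ.minExt m l := by
  obtain ⟨h₁, h₂, h₃, h₄⟩ := h
  exact ⟨h₂, h₁, h₃.symm, by rw [← h₃, h₄, sup_comm]⟩

theorem minExt_self (l : Λ.Path) : Λ.minExt l l = {(Λ.src l, Λ.src l)} := by
  ext ⟨a, b⟩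
  constructor
  · rintro ⟨h₁, h₂, h₃, h₄⟩
    dsimp only at h₁ h₂ h₃ h₄
    have hab := (comp_inj h₁ h₂ rfl h₃).2
    have ha : Λ.deg a = 0 := by
      rw [Λ.deg_comp _ _ h₁, sup_idem] at h₄
      simpa using h₄
    have := eq_rng_of_deg_zero ha
    rw [← h₁] at this
    simp [← hab, this]
  · intro h
    obtain ⟨rfl, rfl⟩ := Prod.mk.inj (Set.mem_singleton_iff.mp h)
    exact ⟨(rng_src l).symm, (rng_src l).symm, rfl, by simp [Λ.comp_src_self]⟩

/-- Every common extension of two paths factors through a minimal one. -/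
theorem exists_minExt_of_comp_eq {a b c d : Λ.Path} (hab : Λ.src a = Λ.rng b)
    (hcd : Λ.src c = Λ.rng d) (h : Λ.comp a b = Λ.comp c d) :
    ∃ a' c' η, (a', c') ∈ Λ.minExt a c ∧ Λ.src a' = Λ.rng η ∧ Λ.src c' = Λ.rng η ∧
      Λ.comp a' η = b ∧ Λ.comp c' η = d := by
  have hle : Λ.deg a ⊔ Λ.deg c ≤ Λ.deg (Λ.comp a b) := by
    refine sup_le ?_ ?_
    · rw [Λ.deg_comp _ _ hab]; exact le_self_add
    · rw [h, Λ.deg_comp _ _ hcd]; exact le_self_add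
  obtain ⟨⟨ζ, η⟩, ⟨hζ, -, hζη, hx⟩, -⟩ :=
    Λ.factorisation (Λ.comp a b) _ _ (add_tsub_cancel_of_le hle).symm
  dsimp only at hζ hζη hx
  have key : ∀ e f : Λ.Path, Λ.src e = Λ.rng f → Λ.comp e f = Λ.comp ζ η →
      Λ.deg e ≤ Λ.deg ζ → ∃ e', Λ.src e = Λ.rng e' ∧ Λ.comp e e' = ζ ∧
        Λ.src e' = Λ.rng η ∧ Λ.comp e' η = f := by
    intro e f hef hE hd
    obtain ⟨⟨e₁, e'⟩, ⟨he₁, -, hs, hc⟩, -⟩ :=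
      Λ.factorisation ζ _ _ (add_tsub_cancel_of_le hd).symm
    dsimp only at he₁ hs hc
    have hs' : Λ.src e' = Λ.rng η := by rw [← hζη, ← hc, Λ.src_comp _ _ hs]
    have hassoc := Λ.comp_assoc e₁ e' η hs hs'
    rw [hc, ← hE] at hassoc
    obtain ⟨rfl, rfl⟩ := comp_inj hef (by rw [Λ.rng_comp _ _ hs', hs]) he₁.symm hassoc
    exact ⟨e', hs, hc, hs', rfl⟩
  obtain ⟨a', ha₁, ha₂, ha₃, ha₄⟩ := key a b hab hx.symm (hζ ▸ le_sup_left)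
  obtain ⟨c', hc₁, hc₂, hc₃, hc₄⟩ := key c d hcd (h.symm.trans hx.symm) (hζ ▸ le_sup_right)
  exact ⟨a', c', η, ⟨ha₁, hc₁, ha₂.trans hc₂.symm, by rw [ha₂, hζ]⟩, ha₃, hc₃, ha₄, hc₄⟩

theorem subset_piSet (E : Set Λ.Path) : E ⊆ Λ.piSet E :=
  Set.subset_sInter fun _ hF => hF.1

theorem piSet_subset {E F : Set Λ.Path} (h : E ⊆ F) (hF : Λ.DaggerClosed F) : Λ.piSet E ⊆ F :=
  Set.sInter_subset_of_mem ⟨h, hF⟩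

theorem daggerClosed_of_left {F : Set Λ.Path}
    (h : ∀ l m σ τ a b, l ∈ F → m ∈ F → σ ∈ F → τ ∈ F → Λ.deg l = Λ.deg m → Λ.deg σ = Λ.deg τ →
      Λ.src l = Λ.src m → Λ.src σ = Λ.src τ → (a, b) ∈ Λ.minExt m σ → Λ.comp l a ∈ F) :
    Λ.DaggerClosed F := fun l m σ τ a b hl hm hσ hτ h₁ h₂ h₃ h₄ hab =>
  ⟨h l m σ τ a b hl hm hσ hτ h₁ h₂ h₃ h₄ hab,
    h τ σ m l b a hτ hσ hm hl h₂.symm h₁.symm h₄.symm h₃.symm (minExt_swap hab)⟩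

theorem daggerClosed_piSet (E : Set Λ.Path) : Λ.DaggerClosed (Λ.piSet E) :=
  fun l m σ τ a b hl hm hσ hτ h₁ h₂ h₃ h₄ hab =>
    ⟨fun F hF => (hF.2 l m σ τ a b (hl F hF) (hm F hF) (hσ F hF) (hτ F hF) h₁ h₂ h₃ h₄ hab).1,
      fun F hF => (hF.2 l m σ τ a b (hl F hF) (hm F hF) (hσ F hF) (hτ F hF) h₁ h₂ h₃ h₄ hab).2⟩

/-- The paths `l a` with `l, m, σ ∈ L` and `(a, b) ∈ Λ^min(m, σ)`, as in condition (†). -/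
def leftExt (Λ : KGraph k) (L : Set Λ.Path) : Set Λ.Path :=
  {x | ∃ l ∈ L, ∃ m ∈ L, ∃ σ ∈ L, ∃ a b, Λ.deg l = Λ.deg m ∧ Λ.src l = Λ.src m ∧
    (a, b) ∈ Λ.minExt m σ ∧ x = Λ.comp l a}

/-- The paths obtained from those in `B` by replacing an initial segment in `L` by another path
of `L` with the same degree and source. -/
def swapInitial (Λ : KGraph k) (L B : Set Λ.Path) : Set Λ.Path :=
  {x | ∃ l ∈ L, ∃ m ∈ L, ∃ a, Λ.deg l = Λ.deg m ∧ Λ.src l = Λ.src m ∧ Λ.src m = Λ.rng a ∧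
    Λ.comp m a ∈ B ∧ x = Λ.comp l a}

theorem finite_leftExt (hΛ : Λ.FinitelyAligned) {L : Set Λ.Path} (hL : L.Finite) :
    (Λ.leftExt L).Finite := by
  refine (hL.biUnion fun l _ => hL.biUnion fun m _ => hL.biUnion fun σ _ =>
    (hΛ m σ).image fun p => Λ.comp l p.1).subset ?_
  rintro x ⟨l, hl, m, hm, σ, hσ, a, b, -, -, hab, rfl⟩
  simp only [Set.mem_iUnion]
  exact ⟨l, hl, m, hm, σ, hσ, (a, b), hab, rfl⟩

theorem finite_swapInitial {L B : Set Λ.Path} (hL : L.Finite) (hB : B.Finite) :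
    (Λ.swapInitial L B).Finite := by
  have hfin : ∀ m : Λ.Path, {a | Λ.src m = Λ.rng a ∧ Λ.comp m a ∈ B}.Finite := fun m =>
    Set.Finite.of_finite_image (f := Λ.comp m)
      (hB.subset (by rintro _ ⟨a, ha, rfl⟩; exact ha.2))
      fun a ha b hb hab => (comp_inj ha.1 hb.1 rfl hab).2
  refine (hL.biUnion fun l _ => hL.biUnion fun m _ => (hfin m).image (Λ.comp l)).subset ?_
  rintro x ⟨l, hl, m, hm, a, -, -, ha, hB, rfl⟩
  simp only [Set.mem_iUnion]
  exact ⟨l, hl, m, hm, a, ⟨ha, hB⟩, rfl⟩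

theorem finite_piSet_inter_deg (hΛ : Λ.FinitelyAligned) {E : Set Λ.Path} (hE : E.Finite)
    (n : Fin k → ℕ) : {x ∈ Λ.piSet E | Λ.deg x = n}.Finite := by
  induction n using WellFoundedLT.induction with
  | ind n ih =>
  set P := Λ.piSet E with hP
  have hPd : Λ.DaggerClosed P := daggerClosed_piSet E
  set L : Set Λ.Path := {x ∈ P | Λ.deg x < n} with hLdef
  have hL : L.Finite := by
    refine ((Set.finite_Iio n).biUnion fun j hj => ih j hj).subset ?_
    intro x hx
    simp only [Set.mem_iUnion]
    exact ⟨Λ.deg x, hx.2, hx.1, rfl⟩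
  set B := E ∪ Λ.leftExt L with hBdef
  have hB : B.Finite := hE.union (finite_leftExt hΛ hL)
  suffices h : P ⊆ {x ∈ P | Λ.deg x = n → x ∈ B ∪ Λ.swapInitial L B} from
    (hB.union (finite_swapInitial hL hB)).subset fun x hx => (h hx.1).2 hx.2
  refine piSet_subset (fun x hx => ⟨subset_piSet E hx, fun _ => .inl (.inl hx)⟩) ?_
  refine daggerClosed_of_left ?_
  rintro l m σ τ a b ⟨hl, hl'⟩ ⟨hm, hm'⟩ ⟨hσ, hσ'⟩ ⟨hτ, -⟩ h₁ h₂ h₃ h₄ hab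
  refine ⟨(hPd l m σ τ a b hl hm hσ hτ h₁ h₂ h₃ h₄ hab).1, fun hn => ?_⟩
  obtain ⟨hma, hσb, hcomp, hdeg⟩ := hab
  dsimp only at hma hσb hcomp hdeg
  have hla : Λ.src l = Λ.rng a := h₃.trans hma
  have hdn : Λ.deg m ⊔ Λ.deg σ = n := by
    rw [← hdeg, Λ.deg_comp _ _ hma, ← h₁, ← Λ.deg_comp _ _ hla, hn]
  by_cases hln : Λ.deg l = n
  · have ha : Λ.deg a = 0 := by
      rw [Λ.deg_comp _ _ hla, hln] at hn
      simpa using hn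
    rw [comp_of_deg_zero hla ha]
    exact hl' hln
  have hmn : Λ.deg m < n := lt_of_le_of_ne (hdn ▸ le_sup_left) (h₁ ▸ hln)
  have hlL : l ∈ L := ⟨hl, h₁ ▸ hmn⟩
  have hmL : m ∈ L := ⟨hm, hmn⟩
  by_cases hσn : Λ.deg σ = n
  swap
  · have hσL : σ ∈ L := ⟨hσ, lt_of_le_of_ne (hdn ▸ le_sup_right) hσn⟩
    exact .inl (.inr ⟨l, hlL, m, hmL, σ, hσL, a, b, h₁, h₃, ⟨hma, hσb, hcomp, hdeg⟩, rfl⟩)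
  have hb : Λ.deg b = 0 := by
    rw [hcomp, Λ.deg_comp _ _ hσb, hdn, hσn] at hdeg
    simpa using hdeg
  rw [comp_of_deg_zero hσb hb] at hcomp
  right
  rcases hσ' hσn with hσB | ⟨l₀, hl₀, m₀, hm₀, a₀, hd₀, hs₀, hma₀, hB₀, hσeq⟩
  · exact ⟨l, hlL, m, hmL, a, h₁, h₃, hma, hcomp ▸ hσB, rfl⟩
  obtain ⟨a', c', η, hmin, haη, hcη, rfl, rfl⟩ :=
    exists_minExt_of_comp_eq (hs₀.trans hma₀) hma (hσeq.symm.trans hcomp.symm)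
  obtain ⟨hla', hmc', hζ, -⟩ := id hmin
  dsimp only at hla' hmc' hζ
  have hlc' : Λ.src l = Λ.rng c' := h₃.trans hmc'
  have hma' : Λ.src m₀ = Λ.rng a' := hs₀ ▸ hla'
  have hdζ : Λ.deg (Λ.comp l₀ a') + Λ.deg η = n := by
    rw [← Λ.deg_comp _ _ (by rw [Λ.src_comp _ _ hla', haη]), Λ.comp_assoc _ _ _ hla' haη,
      ← hσeq, hσn]
  by_cases hζn : Λ.deg (Λ.comp l₀ a') = n
  · have hη : Λ.deg η = 0 := by
      rw [hζn] at hdζ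
      simpa using hdζ
    have : σ ∈ B := by
      rw [hσeq, comp_of_deg_zero haη hη]
      exact .inr ⟨l₀, hl₀, l₀, hl₀, m, hmL, a', c', rfl, rfl, hmin, rfl⟩
    exact ⟨l, hlL, m, hmL, _, h₁, h₃, hma, hcomp ▸ this, rfl⟩
  have hζlt : Λ.deg (Λ.comp l₀ a') < n := lt_of_le_of_ne (hdζ ▸ le_self_add) hζn
  have hdm : Λ.deg (Λ.comp m₀ a') = Λ.deg (Λ.comp l₀ a') := by
    rw [Λ.deg_comp _ _ hma', Λ.deg_comp _ _ hla', hd₀]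
  have hdl : Λ.deg (Λ.comp l c') = Λ.deg (Λ.comp l₀ a') := by
    rw [hζ, Λ.deg_comp _ _ hlc', Λ.deg_comp _ _ hmc', h₁]
  refine ⟨Λ.comp l c', ⟨(hPd l₀ l₀ m l a' c' hl₀.1 hl₀.1 hm hl rfl h₁.symm rfl h₃.symm hmin).2,
    hdl ▸ hζlt⟩, Λ.comp m₀ a',
    ⟨(hPd m₀ l₀ m m a' c' hm₀.1 hl₀.1 hm hm hd₀.symm rfl hs₀.symm rfl hmin).1, hdm ▸ hζlt⟩, η,
    hdl.trans hdm.symm, ?_, ?_, ?_, ?_⟩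
  · rw [Λ.src_comp _ _ hlc', Λ.src_comp _ _ hma', haη, hcη]
  · rw [Λ.src_comp _ _ hma', haη]
  · rwa [Λ.comp_assoc _ _ _ hma' haη]
  · rw [Λ.comp_assoc _ _ _ hlc' hcη]

theorem finite_piSet (hΛ : Λ.FinitelyAligned) {E : Set Λ.Path} (hE : E.Finite) :
    (Λ.piSet E).Finite := by
  obtain ⟨N, hN⟩ := (hE.image Λ.deg).bddAbove
  have hdeg : Λ.piSet E ⊆ {x | Λ.deg x ≤ N} := by
    refine piSet_subset (fun x hx => hN ⟨x, hx, rfl⟩) (daggerClosed_of_left ?_)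
    rintro l m σ τ a b hl hm hσ - h₁ - h₃ - ⟨hma, -, -, hd⟩
    dsimp only at hma hd
    rw [Set.mem_ofPred_eq, Λ.deg_comp _ _ (h₃.trans hma), h₁, ← Λ.deg_comp _ _ hma, hd]
    exact sup_le hm hσ
  refine ((Set.finite_Iic N).biUnion fun n _ => finite_piSet_inter_deg hΛ hE n).subset ?_
  intro x hx
  simp only [Set.mem_iUnion]
  exact ⟨Λ.deg x, hdeg hx, hx, rfl⟩

theorem finite_extInto {P : Set Λ.Path} (hP : P.Finite) (l : Λ.Path) : (Λ.extInto P l).Finite :=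
  Set.Finite.of_finite_image (f := Λ.comp l)
    (hP.subset (by rintro _ ⟨a, ha, rfl⟩; exact ha.2.2))
    fun _ ha _ hb hab => (comp_inj ha.1 hb.1 rfl hab).2

namespace IsCK13

variable {A : Type*} [Ring A] [StarRing A] {t : Λ.Path → A}

theorem star_mul_self (ht : Λ.IsCK13 t) (l : Λ.Path) : star (t l) * t l = t (Λ.src l) := by
  have hv := ht.vertex_projection _ (Λ.deg_src l)
  rw [ht.ck3, minExt_self, setSum, dif_pos (Set.finite_singleton _)]
  simp [hv.1, hv.2]

theorem mul_src (ht : Λ.IsCK13 t) (l : Λ.Path) : t l * t (Λ.src l) = t l := by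
  rw [ht.comp_mul _ _ (rng_src l).symm, Λ.comp_src_self]

theorem rng_mul (ht : Λ.IsCK13 t) (l : Λ.Path) : t (Λ.rng l) * t l = t l := by
  rw [ht.comp_mul _ _ (Λ.src_eq_of_deg_zero _ (Λ.deg_rng l)), Λ.rng_comp_self]

theorem src_mul_star (ht : Λ.IsCK13 t) (l : Λ.Path) : t (Λ.src l) * star (t l) = star (t l) := by
  have h := congrArg star (ht.mul_src l)
  rwa [star_mul, (ht.vertex_projection _ (Λ.deg_src l)).1] at h

theorem star_mul_rng (ht : Λ.IsCK13 t) (l : Λ.Path) : star (t l) * t (Λ.rng l) = star (t l) := by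
  have h := congrArg star (ht.rng_mul l)
  rwa [star_mul, (ht.vertex_projection _ (Λ.deg_rng l)).1] at h

theorem star_mul_eq_zero (ht : Λ.IsCK13 t) {l m : Λ.Path} (h : ¬(Λ.minExt l m).Nonempty) :
    star (t l) * t m = 0 := by
  rw [ht.ck3, Set.not_nonempty_iff_eq_empty.mp h, setSum, dif_pos Set.finite_empty]
  simp

theorem range_mul_prod (ht : Λ.IsCK13 t) (l : Λ.Path) (L : List Λ.Path)
    (hL : ∀ ν ∈ L, Λ.src l = Λ.rng ν) :
    t l * star (t l) * (L.map fun ν =>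
        t l * star (t l) - t (Λ.comp l ν) * star (t (Λ.comp l ν))).prod =
      t l * (L.map fun ν => t (Λ.src l) - t ν * star (t ν)).prod * star (t l) := by
  induction L with
  | nil => simp
  | cons ν L ih =>
    have hν := hL ν (by simp)
    have ih := ih fun κ hκ => hL κ (by simp [hκ])
    simp only [List.map_cons, List.prod_cons]
    have hy : t l * star (t l) - t (Λ.comp l ν) * star (t (Λ.comp l ν)) =
        t l * (t (Λ.src l) - t ν * star (t ν)) * star (t l) := by
      rw [← ht.comp_mul _ _ hν, mul_sub, sub_mul, ht.mul_src, star_mul]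
      simp only [mul_assoc]
    have hyv : (t (Λ.src l) - t ν * star (t ν)) * t (Λ.src l) =
        t (Λ.src l) - t ν * star (t ν) := by
      rw [sub_mul, (ht.vertex_projection _ (Λ.deg_src l)).2, mul_assoc, hν, ht.star_mul_rng]
    rw [hy]
    set y := t (Λ.src l) - t ν * star (t ν)
    have hc : t l * star (t l) * (t l * y * star (t l)) =
        t l * y * star (t l) * (t l * star (t l)) := by
      calc t l * star (t l) * (t l * y * star (t l))
          = (t l * star (t l) * t l) * y * star (t l) := by simp only [mul_assoc]
        _ = t l * (y * t (Λ.src l)) * star (t l) := by rw [ht.partialIsometry, hyv]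
        _ = t l * y * star (t l) * (t l * star (t l)) := by
          rw [← ht.star_mul_self]; simp only [mul_assoc]
    rw [← mul_assoc, hc, mul_assoc, ih]
    generalize (L.map fun ν => t (Λ.src l) - t ν * star (t ν)).prod = R
    calc t l * y * star (t l) * (t l * R * star (t l))
        = t l * (y * (star (t l) * t l)) * R * star (t l) := by simp only [mul_assoc]
      _ = _ := by rw [ht.star_mul_self, hyv]; simp only [mul_assoc]

theorem theta_eq (ht : Λ.IsCK13 t) {E : Set Λ.Path} {l m : Λ.Path} (hsrc : Λ.src l = Λ.src m)
    (hfin : (Λ.extInto (Λ.piSet E) l).Finite) :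
    Λ.Theta t E l m = t l * setProd (Λ.extInto (Λ.piSet E) l)
      (fun ν => t (Λ.src l) - t ν * star (t ν)) * star (t m) := by
  have hL : ∀ ν ∈ hfin.toFinset.toList, Λ.src l = Λ.rng ν := fun ν hν => by
    simp only [Finset.mem_toList, Set.Finite.mem_toFinset] at hν
    exact hν.1
  simp only [Theta, Qproj, setProd, dif_pos hfin]
  rw [ht.range_mul_prod l _ hL, ← mul_assoc, mul_assoc _ (star (t l)), ht.star_mul_self,
    mul_assoc, hsrc, ht.src_mul_star]

theorem prod_mul_of_disjoint (ht : Λ.IsCK13 t) {v σ : Λ.Path} (hσ : Λ.rng σ = v)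
    (L : List Λ.Path) (hL : ∀ ν ∈ L, ¬(Λ.minExt ν σ).Nonempty) :
    (L.map fun ν => t v - t ν * star (t ν)).prod * t σ = t σ := by
  induction L with
  | nil => simp
  | cons ν L ih =>
    rw [List.map_cons, List.prod_cons, mul_assoc, ih fun κ hκ => hL κ (by simp [hκ]), sub_mul,
      mul_assoc, ht.star_mul_eq_zero (hL ν (by simp)), ← hσ, ht.rng_mul, mul_zero, sub_zero]

end IsCK13

end KGraph

/-- if every vertex projection is nonzero, then `Θ(t,E;l,m) = 0` iff
`T(l)` is exhaustive. -/
theorem stmt14 {k : ℕ} (Λ : KGraph k) (hΛ : Λ.FinitelyAligned)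
    (E : Set Λ.Path) (hE : E.Finite) {A : Type*} [CStarAlgebra A]
    (t : Λ.Path → A) (ht : Λ.IsCKFamily t)
    (hnz : ∀ v, Λ.IsVertex v → t v ≠ 0)
    (l m : Λ.Path) (hl : l ∈ Λ.piSet E) (hm : m ∈ Λ.piSet E)
    (hdeg : Λ.deg l = Λ.deg m) (hsrc : Λ.src l = Λ.src m) :
    Λ.Theta t E l m = 0 ↔
      Λ.Exhaustive (Λ.src l) (Λ.extInto (Λ.piSet E) l) := by
  have hfin := KGraph.finite_extInto (KGraph.finite_piSet hΛ hE) l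
  have hck := ht.toIsCK13
  rw [hck.theta_eq hsrc hfin]
  constructor
  · intro h
    by_contra hne
    simp only [KGraph.Exhaustive, not_forall, not_exists, not_and] at hne
    obtain ⟨σ, hσ, hdisj⟩ := hne
    have hσ' : Λ.rng σ = Λ.src l := hσ
    refine hnz _ (Λ.deg_src σ) ?_
    rw [← hck.star_mul_self]
    suffices t σ = 0 by rw [this, mul_zero]
    rw [setProd, dif_pos hfin] at h
    have hprod := hck.prod_mul_of_disjoint hσ' hfin.toFinset.toList
      (fun ν hν => hdisj ν (by simpa using hν))
    have hvσ : t (Λ.src l) * t σ = t σ := hσ' ▸ hck.rng_mul σ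
    generalize (hfin.toFinset.toList.map fun ν => t (Λ.src l) - t ν * star (t ν)).prod = R
      at h hprod
    calc t σ = t (Λ.src l) * (R * (t (Λ.src m) * t σ)) := by rw [← hsrc, hvσ, hprod, hvσ]
      _ = star (t l) * (t l * R * star (t m)) * t m * t σ := by
        rw [← hck.star_mul_self l, ← hck.star_mul_self m]; simp only [mul_assoc]
      _ = 0 := by rw [h]; simp
  · intro h
    rw [ht.ck4 _ _ (Λ.deg_src l) (fun ν hν => hν.1.symm) hfin h]
    simp
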